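/- Let U be a domain in ℝ^m and E a family of harmonic functions on U. Then E is normal if and only if for every compact subset K ⊆ U there exists a constant M_K > 0 such that f̃(x) ≤ M_K for every f ∈ E and every x ∈ K. -/

import Mathlib

open Filter Topology Metric

noncomputable section

/-- `ℝ^m` with the Euclidean structure. -/
abbrev E (m : ℕ) := EuclideanSpace ℝ (Fin m)

/-- The Laplacian of `f` at `x`. -/
noncomputable def lap {m : ℕ} (f : E m → ℝ) (x : E m) : ℝ :=
  ∑ i, fderiv ℝ (fun y => fderiv ℝ f y (EuclideanSpace.single i 1)) x (EuclideanSpace.single i 1)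

/-- `f` is harmonic on `U`: real-valued, `C²` with vanishing Laplacian. -/
def HarmOn {m : ℕ} (U : Set (E m)) (f : E m → ℝ) : Prop :=
  ContDiffOn ℝ 2 f U ∧ ∀ x ∈ U, lap f x = 0

/-- `f̃ x = |∇f(x)| / cosh (f x)`. -/
noncomputable def tilde {m : ℕ} (f : E m → ℝ) (x : E m) : ℝ :=
  ‖gradient f x‖ / Real.cosh (f x)

/-- `S(x) = arctan (sinh x)`, extended to `[-∞,+∞]` by `S(±∞) = ±π/2`.  The distance on
`[-∞,+∞]` is `d(x,y) = |S x - S y|`. -/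
noncomputable def SF : EReal → ℝ := fun x =>
  if x = ⊤ then Real.pi / 2 else if x = ⊥ then -(Real.pi / 2)
  else Real.arctan (Real.sinh x.toReal)

/-- Uniform convergence on every compact subset of `U`, with respect to the distance
`d(x,y) = |S x - S y|` on `[-∞,+∞]`. -/
def TendstoCptsE {m : ℕ} (U : Set (E m)) (g : ℕ → E m → EReal) (G : E m → EReal) : Prop :=
  ∀ K ⊆ U, IsCompact K → ∀ ε > 0, ∃ N : ℕ, ∀ n ≥ N, ∀ x ∈ K, |SF (g n x) - SF (G x)| < ε

/-- A family `Fam` of harmonic functions on `U` is normal if every sequence in `Fam` has a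
subsequence converging uniformly on compact subsets of `U` either to a harmonic function on
`U`, or to the constant `+∞`, or to the constant `-∞`. -/
def NormalFam {m : ℕ} (U : Set (E m)) (Fam : Set (E m → ℝ)) : Prop :=
  ∀ f : ℕ → E m → ℝ, (∀ n, f n ∈ Fam) →
    ∃ φ : ℕ → ℕ, StrictMono φ ∧
      ((∃ g : E m → ℝ, HarmOn U g ∧
          TendstoCptsE U (fun k x => ((f (φ k) x : ℝ) : EReal)) (fun x => ((g x : ℝ) : EReal)))
       ∨ TendstoCptsE U (fun k x => ((f (φ k) x : ℝ) : EReal)) (fun _ => (⊤ : EReal))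
       ∨ TendstoCptsE U (fun k x => ((f (φ k) x : ℝ) : EReal)) (fun _ => (⊥ : EReal)))


open MeasureTheory Convolution

/-- the derivative of `expNegInvGlue` -/
def hh (s : ℝ) : ℝ := (s⁻¹) ^ 2 * expNegInvGlue s

theorem hh_eq : hh = fun s => (Polynomial.X ^ 2 : Polynomial ℝ).eval (s⁻¹) * expNegInvGlue s := by
  funext s; simp [hh]

theorem hh_contDiff : ContDiff ℝ 2 hh := by
  rw [hh_eq]
  exact expNegInvGlue.contDiff_polynomial_eval_inv_mul (n := 2) _

theorem hh_hasDerivAt (s : ℝ) : HasDerivAt expNegInvGlue (hh s) s := by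
  have := expNegInvGlue.hasDerivAt_polynomial_eval_inv_mul 1 s
  simpa [hh] using this

theorem hh_nonneg (s : ℝ) : 0 ≤ hh s := mul_nonneg (sq_nonneg _) (expNegInvGlue.nonneg _)

theorem hh_pos {s : ℝ} (h : 0 < s) : 0 < hh s :=
  mul_pos (by positivity) (expNegInvGlue.pos_of_pos h)

theorem hh_zero {s : ℝ} (h : s ≤ 0) : hh s = 0 := by
  simp [hh, expNegInvGlue.zero_of_nonpos h]

variable {m : ℕ}

/-- the radial kernel -/
def kk (R : ℝ) (w : E m) : ℝ := hh (R ^ 2 - ‖w‖ ^ 2)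

/-- its radial potential -/
def Psi (R : ℝ) (w : E m) : ℝ := expNegInvGlue (R ^ 2 - ‖w‖ ^ 2)

theorem kk_nonneg (R : ℝ) (w : E m) : 0 ≤ kk R w := hh_nonneg _

theorem kk_pos {R : ℝ} {w : E m} (h : ‖w‖ < R) : 0 < kk R w := by
  apply hh_pos
  have := norm_nonneg w
  nlinarith

theorem kk_zero {R : ℝ} (hR : 0 < R) {w : E m} (h : R ≤ ‖w‖) : kk R w = 0 := by
  apply hh_zero
  nlinarith

theorem Psi_zero {R : ℝ} (hR : 0 < R) {w : E m} (h : R ≤ ‖w‖) : Psi R w = 0 := by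
  apply expNegInvGlue.zero_of_nonpos
  nlinarith

theorem kk_neg (R : ℝ) (w : E m) : kk R (-w) = kk R w := by simp [kk]

theorem kk_contDiff (R : ℝ) : ContDiff ℝ 2 (kk R : E m → ℝ) :=
  hh_contDiff.comp (contDiff_const.sub (contDiff_norm_sq ℝ))

theorem Psi_contDiff (R : ℝ) : ContDiff ℝ 2 (Psi R : E m → ℝ) :=
  (expNegInvGlue.contDiff (n := 2)).comp (contDiff_const.sub (contDiff_norm_sq ℝ))

theorem kk_tsupport {R : ℝ} (hR : 0 < R) : tsupport (kk R : E m → ℝ) ⊆ closedBall 0 R := by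
  apply closure_minimal _ isClosed_closedBall
  intro w hw
  by_contra h
  simp at h
  exact hw (kk_zero hR h.le)

theorem kk_hcs {R : ℝ} (hR : 0 < R) : HasCompactSupport (kk R : E m → ℝ) :=
  (isCompact_closedBall 0 R).of_isClosed_subset (isClosed_tsupport _) (kk_tsupport hR)

theorem Psi_hcs {R : ℝ} (hR : 0 < R) : HasCompactSupport (Psi R : E m → ℝ) := by
  apply HasCompactSupport.intro (isCompact_closedBall 0 R)
  intro w hw
  simp at hw
  exact Psi_zero hR hw.le

theorem kk_int_pos {R : ℝ} (hR : 0 < R) : 0 < ∫ w : E m, kk R w := by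
  apply (kk_contDiff R).continuous.integral_pos_of_hasCompactSupport_nonneg_nonzero (kk_hcs hR)
    (kk_nonneg R) (x := 0)
  exact (kk_pos (by simpa using hR)).ne'

theorem Psi_fderiv (R : ℝ) (w v : E m) : fderiv ℝ (Psi R) w v = -2 * kk R w * inner ℝ w v := by
  have h1 : HasFDerivAt (fun w : E m => R ^ 2 - ‖w‖ ^ 2) (-(2 • (innerSL ℝ w))) w :=
    ((hasStrictFDerivAt_norm_sq w).hasFDerivAt).const_sub _
  have h2 := (hh_hasDerivAt (R ^ 2 - ‖w‖ ^ 2)).comp_hasFDerivAt w h1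
  have h3 : HasFDerivAt (Psi R) _ w := h2
  rw [h3.fderiv]
  simp [kk]
  ring

theorem sum_single (w : E m) : w = ∑ i, w i • EuclideanSpace.single i (1 : ℝ) := by
  ext j
  simp [Finset.sum_apply, Pi.single_apply]

theorem ibp {F : E m → ℝ} (hF : ContDiff ℝ 2 F) (x : E m) {R : ℝ} (hR : 0 < R)
    (hl : ∀ y ∈ ball x R, lap F y = 0) {t : ℝ} (ht : t ∈ Set.Icc (0:ℝ) 1) :
    ∫ w, fderiv ℝ F (x + t • w) w * kk R w = 0 := by
  have hF1 : ContDiff ℝ 1 (fderiv ℝ F) := hF.fderiv_right (by norm_num)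
  let D : Fin m → E m → ℝ := fun i y => fderiv ℝ F y (EuclideanSpace.single i 1)
  have hD : ∀ i, ContDiff ℝ 1 (D i) := fun i => hF1.clm_apply contDiff_const
  have hDx : ∀ i, ContDiff ℝ 1 (fun w => D i (x + t • w)) := fun i =>
    (hD i).comp (by fun_prop)
  have hfd : ∀ i w, fderiv ℝ (fun w => D i (x + t • w)) w (EuclideanSpace.single i 1)
      = t * fderiv ℝ (D i) (x + t • w) (EuclideanSpace.single i 1) := by
    intro i w
    have h1 : HasFDerivAt (fun w : E m => x + t • w) (t • ContinuousLinearMap.id ℝ (E m)) w :=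
      ((hasFDerivAt_id w).const_smul t).const_add x
    have h2 := (((hD i).differentiable (by norm_num)) (x + t • w)).hasFDerivAt.comp w h1
    have h3 : HasFDerivAt (fun w => D i (x + t • w)) _ w := h2
    rw [h3.fderiv]
    simp
  have hcont1 : ∀ i, Continuous (fun w => fderiv ℝ (Psi R) w (EuclideanSpace.single i (1:ℝ) : E m)) :=
    fun i => ((Psi_contDiff R).continuous_fderiv (by norm_num)).clm_apply continuous_const
  have hcs1 : ∀ i, HasCompactSupport (fun w => fderiv ℝ (Psi R) w (EuclideanSpace.single i (1:ℝ) : E m)) :=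
    fun i => (Psi_hcs hR).fderiv_apply ℝ _
  have hcont2 : ∀ i, Continuous (fun w => fderiv ℝ (fun w => D i (x + t • w)) w (EuclideanSpace.single i 1)) :=
    fun i => ((hDx i).continuous_fderiv (by norm_num)).clm_apply continuous_const
  have hi1 : ∀ i, Integrable (fun w => fderiv ℝ (fun w => D i (x + t • w)) w (EuclideanSpace.single i 1) * Psi R w) :=
    fun i => ((hcont2 i).mul (Psi_contDiff R).continuous).integrable_of_hasCompactSupport
      (Psi_hcs hR).mul_left
  have hi2 : ∀ i, Integrable (fun w => D i (x + t • w) * fderiv ℝ (Psi R) w (EuclideanSpace.single i 1)) :=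
    fun i => ((hDx i).continuous.mul (hcont1 i)).integrable_of_hasCompactSupport (hcs1 i).mul_left
  have hI : ∀ i, ∫ w, D i (x + t • w) * fderiv ℝ (Psi R) w (EuclideanSpace.single i 1)
      = - ∫ w, fderiv ℝ (fun w => D i (x + t • w)) w (EuclideanSpace.single i 1) * Psi R w := by
    intro i
    apply integral_mul_fderiv_eq_neg_fderiv_mul_of_integrable (hi1 i) (hi2 i)
    · exact ((hDx i).continuous.mul (Psi_contDiff R).continuous).integrable_of_hasCompactSupport
        (Psi_hcs hR).mul_left
    · exact fun w _ => (hDx i).differentiable (by norm_num) w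
    · exact fun w _ => (Psi_contDiff R).differentiable (by norm_num) w
  have e1 : ∀ w, fderiv ℝ F (x + t • w) w * kk R w
      = (-1/2) * ∑ i, D i (x + t • w) * fderiv ℝ (Psi R) w (EuclideanSpace.single i 1) := by
    intro w
    conv_lhs => rw [show fderiv ℝ F (x + t • w) w =
      fderiv ℝ F (x + t • w) (∑ i, w i • EuclideanSpace.single i (1 : ℝ)) by rw [← sum_single w]]
    rw [map_sum, Finset.sum_mul, Finset.mul_sum]
    refine Finset.sum_congr rfl fun i _ => ?_
    rw [Psi_fderiv, map_smul]
    simp [D, EuclideanSpace.inner_single_right]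
    ring
  have e2 : ∀ w, ∑ i, fderiv ℝ (fun w => D i (x + t • w)) w (EuclideanSpace.single i 1) * Psi R w = 0 := by
    intro w
    rw [← Finset.sum_mul]
    by_cases hw : R ≤ ‖w‖
    · rw [Psi_zero hR hw, mul_zero]
    · have : x + t • w ∈ ball x R := by
        rw [mem_ball_iff_norm]
        simp only [add_sub_cancel_left, norm_smul, Real.norm_eq_abs, abs_of_nonneg ht.1]
        push Not at hw
        nlinarith [ht.2, ht.1, norm_nonneg w]
      have h := hl _ this
      simp only [hfd, ← Finset.mul_sum]
      unfold lap at h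
      simp only [D]
      rw [h]; simp
  simp_rw [e1]
  rw [integral_const_mul, integral_finsetSum _ (fun i _ => hi2 i)]
  simp_rw [hI]
  rw [Finset.sum_neg_distrib, ← integral_finsetSum _ (fun i _ => hi1 i)]
  simp_rw [e2]
  simp

theorem mvp {F : E m → ℝ} (hF : ContDiff ℝ 2 F) (x : E m) {R : ℝ} (hR : 0 < R)
    (hl : ∀ y ∈ ball x R, lap F y = 0) :
    ∫ w, F (x + w) * kk R w = F x * ∫ w : E m, kk R w := by
  have hder : ∀ t : ℝ, HasDerivAt (fun t : ℝ => ∫ w, F (x + t • w) * kk R w)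
      (∫ w, fderiv ℝ F (x + t • w) w * kk R w) t := by
    intro t₀
    have hc : Continuous (fun p : ℝ × E m => fderiv ℝ F (x + p.1 • p.2) p.2) := by
      have : Continuous (fderiv ℝ F) := hF.continuous_fderiv (by norm_num)
      fun_prop
    obtain ⟨C, hC⟩ := ((isCompact_closedBall t₀ 1).prod (isCompact_closedBall (0 : E m) R)).exists_bound_of_continuousOn hc.continuousOn
    have hkc : Continuous (kk R : E m → ℝ) := (kk_contDiff R).continuous
    have hFc := hF.continuous
    have hFd : Continuous (fderiv ℝ F) := hF.continuous_fderiv (by norm_num)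
    refine (hasDerivAt_integral_of_dominated_loc_of_deriv_le (s := closedBall t₀ 1)
      (F := fun (t : ℝ) (w : E m) => F (x + t • w) * kk R w)
      (F' := fun (t : ℝ) (w : E m) => fderiv ℝ F (x + t • w) w * kk R w)
      (bound := fun w => C * kk R w) (closedBall_mem_nhds _ one_pos) ?_ ?_ ?_ ?_ ?_ ?_).2
    · refine Eventually.of_forall fun t => Continuous.aestronglyMeasurable ?_
      fun_prop
    · apply Continuous.integrable_of_hasCompactSupport
      · fun_prop
      · exact (kk_hcs hR).mul_left
    · apply Continuous.aestronglyMeasurable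
      fun_prop
    · refine Eventually.of_forall fun w t ht => ?_
      rw [norm_mul, Real.norm_of_nonneg (kk_nonneg R w)]
      by_cases hw : R ≤ ‖w‖
      · rw [kk_zero hR hw]; simp
      · push Not at hw
        exact mul_le_mul_of_nonneg_right (hC (t, w) ⟨ht, by simpa using hw.le⟩) (kk_nonneg R w)
    · exact (hkc.integrable_of_hasCompactSupport (kk_hcs hR)).const_mul C
    · refine Eventually.of_forall fun w t _ => ?_
      have h1 : HasDerivAt (fun t : ℝ => x + t • w) w t := by
        have h := ((hasDerivAt_id t).smul_const w).const_add x
        rw [one_smul] at h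
        exact h
      have h0 : DifferentiableAt ℝ F (x + t • w) := hF.differentiable (by norm_num) _
      have h2 : HasDerivAt (fun t : ℝ => F (x + t • w)) (fderiv ℝ F (x + t • w) w) t :=
        h0.hasFDerivAt.comp_hasDerivAt t h1
      exact h2.mul_const _
  have := constant_of_derivWithin_zero (f := fun t : ℝ => ∫ w, F (x + t • w) * kk R w)
    (a := 0) (b := 1) (fun t _ => (hder t).differentiableAt.differentiableWithinAt) (by
      intro t ht
      rw [((hder t).hasDerivWithinAt).derivWithin (uniqueDiffOn_Icc one_pos t ⟨ht.1, ht.2.le⟩)]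
      exact ibp hF x hR hl ⟨ht.1, ht.2.le⟩) 1 (by simp)
  simp only [one_smul, zero_smul, add_zero] at this
  rw [this, integral_const_mul]

/-- convolution -/
def cv (F k : E m → ℝ) (x : E m) : ℝ := ∫ y, F y * k (x - y)

theorem cv_eq (F k : E m → ℝ) : cv F k = (F ⋆[ContinuousLinearMap.mul ℝ ℝ, volume] k) := rfl

theorem cv_contDiff {F k : E m → ℝ} (hF : Continuous F) (hk : ContDiff ℝ 2 k)
    (hc : HasCompactSupport k) : ContDiff ℝ 2 (cv F k) := by
  rw [cv_eq]
  exact hc.contDiff_convolution_right (n := 2) _ hF.locallyIntegrable hk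

theorem cv_fderiv {F k : E m → ℝ} (hF : Continuous F) (hk : ContDiff ℝ 1 k)
    (hc : HasCompactSupport k) (x v : E m) :
    fderiv ℝ (cv F k) x v = cv F (fun y => fderiv ℝ k y v) x := by
  rw [cv_eq, (hc.hasFDerivAt_convolution_right (ContinuousLinearMap.mul ℝ ℝ)
    hF.locallyIntegrable hk x).fderiv]
  rw [convolution_precompR_apply _ hF.locallyIntegrable (hc.fderiv ℝ)
    (hk.continuous_fderiv one_ne_zero)]
  rfl

theorem cv_lap {F k : E m → ℝ} (hF : Continuous F) (hk : ContDiff ℝ 2 k)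
    (hc : HasCompactSupport k) (x : E m) :
    lap (cv F k) x = cv F (lap k) x := by
  have hk1 : ContDiff ℝ 1 (fderiv ℝ k) := hk.fderiv_right (by norm_num)
  have hkv : ∀ v, ContDiff ℝ 1 (fun y => fderiv ℝ k y v) := fun v => hk1.clm_apply contDiff_const
  have hcv : ∀ v, HasCompactSupport (fun y => fderiv ℝ k y v) := fun v => hc.fderiv_apply ℝ v
  unfold lap
  have : ∀ v : E m, (fun y => fderiv ℝ (cv F k) y v) = cv F (fun y => fderiv ℝ k y v) := by
    intro v; funext y; exact cv_fderiv hF (hk.of_le (by norm_num)) hc y v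
  simp_rw [this]
  simp_rw [cv_fderiv hF (hkv _) (hcv _)]
  unfold cv
  rw [← integral_finsetSum]
  · simp_rw [Finset.mul_sum]
  · intro i _
    have h1 : Continuous (fun y => fderiv ℝ (fun y => fderiv ℝ k y (EuclideanSpace.single i 1)) y (EuclideanSpace.single i (1:ℝ))) :=
      ((hkv _).continuous_fderiv (by norm_num)).clm_apply continuous_const
    have h2 : HasCompactSupport (fun y => fderiv ℝ (fun y => fderiv ℝ k y (EuclideanSpace.single i 1)) y (EuclideanSpace.single i (1:ℝ))) :=
      (hcv _).fderiv_apply ℝ _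
    apply Continuous.integrable_of_hasCompactSupport
    · exact hF.mul (h1.comp (by fun_prop))
    · exact (h2.comp_homeomorph (Homeomorph.subLeft x)).mul_left

theorem lap_continuous {k : E m → ℝ} (hk : ContDiff ℝ 2 k) : Continuous (lap k) := by
  have hk1 : ContDiff ℝ 1 (fderiv ℝ k) := hk.fderiv_right (by norm_num)
  have hkv : ∀ v, ContDiff ℝ 1 (fun y => fderiv ℝ k y v) := fun v => hk1.clm_apply contDiff_const
  exact continuous_finsetSum _ fun i _ =>
    ((hkv _).continuous_fderiv (by norm_num)).clm_apply continuous_const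

theorem mvp_cv {F : E m → ℝ} (hF : ContDiff ℝ 2 F) (x : E m) {R : ℝ} (hR : 0 < R)
    (hl : ∀ y ∈ ball x R, lap F y = 0) :
    cv F (kk R) x = F x * ∫ w : E m, kk R w := by
  rw [← mvp hF x hR hl]
  unfold cv
  rw [← integral_add_left_eq_self _ x]
  congr 1; funext w
  rw [show x - (x + w) = -w by abel, kk_neg]

theorem lap_congr {f g : E m → ℝ} {x : E m} (h : f =ᶠ[𝓝 x] g) : lap f x = lap g x := by
  unfold lap
  refine Finset.sum_congr rfl fun i _ => ?_
  have : (fun y => fderiv ℝ f y (EuclideanSpace.single i 1)) =ᶠ[𝓝 x]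
      (fun y => fderiv ℝ g y (EuclideanSpace.single i 1)) := by
    filter_upwards [h.eventuallyEq_nhds] with y hy
    rw [hy.fderiv_eq]
  rw [this.fderiv_eq]

theorem HarmOn.neg {U : Set (E m)} {f : E m → ℝ} (h : HarmOn U f) : HarmOn U (fun x => - f x) := by
  refine ⟨h.1.neg, fun x hx => ?_⟩
  have := h.2 x hx
  unfold lap at this ⊢
  simp only [fderiv_fun_neg, neg_apply, Finset.sum_neg_distrib, this, neg_zero]

theorem HarmOn.add_const {U : Set (E m)} {f : E m → ℝ} (h : HarmOn U f) (c : ℝ) :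
    HarmOn U (fun x => f x + c) := by
  refine ⟨h.1.add contDiffOn_const, fun x hx => ?_⟩
  have := h.2 x hx
  unfold lap at this ⊢
  simpa only [fderiv_add_const] using this

/-- cutoff function -/
theorem exists_cut (x : E m) {R : ℝ} (hR : 0 < R) : ∃ χ : E m → ℝ, ContDiff ℝ 2 χ ∧
    (∀ y, 0 ≤ χ y) ∧ (∀ y, χ y ≤ 1) ∧ (∀ y ∈ ball x R, χ y = 1) ∧ tsupport χ ⊆ closedBall x (2 * R) := by
  let b : ContDiffBump x := ⟨R, 2 * R, hR, by linarith⟩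
  refine ⟨b, b.contDiff (n := 2), fun y => b.nonneg, fun y => b.le_one, fun y hy => ?_, ?_⟩
  · exact b.one_of_mem_closedBall (ball_subset_closedBall hy)
  · exact b.tsupport_eq.subset

theorem cut_cont {U : Set (E m)} (hU : IsOpen U) {χ f : E m → ℝ} (hχ : Continuous χ)
    (hs : tsupport χ ⊆ U) (hf : ContinuousOn f U) : Continuous (fun y => χ y * f y) := by
  rw [continuous_iff_continuousAt]
  intro y
  by_cases hy : y ∈ tsupport χ
  · exact hχ.continuousAt.mul (hf.continuousAt (hU.mem_nhds (hs hy)))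
  · have : (fun y => χ y * f y) =ᶠ[𝓝 y] fun _ => 0 := by
      filter_upwards [(isClosed_tsupport χ).isOpen_compl.mem_nhds hy] with z hz
      rw [image_eq_zero_of_notMem_tsupport hz, zero_mul]
    exact continuousAt_const.congr this.symm

theorem cut_contDiff {U : Set (E m)} (hU : IsOpen U) {χ f : E m → ℝ} (hχ : ContDiff ℝ 2 χ)
    (hs : tsupport χ ⊆ U) (hf : ContDiffOn ℝ 2 f U) : ContDiff ℝ 2 (fun y => χ y * f y) := by
  rw [contDiff_iff_contDiffAt]
  intro y
  by_cases hy : y ∈ tsupport χ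
  · exact hχ.contDiffAt.mul (hf.contDiffAt (hU.mem_nhds (hs hy)))
  · have : (fun y => χ y * f y) =ᶠ[𝓝 y] fun _ => 0 := by
      filter_upwards [(isClosed_tsupport χ).isOpen_compl.mem_nhds hy] with z hz
      rw [image_eq_zero_of_notMem_tsupport hz, zero_mul]
    exact contDiffAt_const.congr_of_eventuallyEq this

theorem cut_eq {χ f : E m → ℝ} {x y : E m} {R : ℝ}
    (h1 : ∀ y ∈ ball x R, χ y = 1) (hy : y ∈ ball x R) : (fun y => χ y * f y) =ᶠ[𝓝 y] f := by
  filter_upwards [isOpen_ball.mem_nhds hy] with z hz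
  rw [h1 z hz, one_mul]

/-- kernel comparison -/
theorem kernel_bound {R : ℝ} (hR : 0 < R) : ∃ C : ℝ, 0 ≤ C ∧ ∀ w : E m,
    ‖fderiv ℝ (kk (R / 2)) w‖ ≤ C * kk R w := by
  have hc : Continuous (fderiv ℝ (kk (R / 2) : E m → ℝ)) := (kk_contDiff _).continuous_fderiv (by norm_num)
  have hR2 : 0 < R / 2 := by linarith
  have hcomp := isCompact_closedBall (0 : E m) (R / 2)
  have hpos : ∀ w ∈ closedBall (0 : E m) (R / 2), 0 < kk R w := by
    intro w hw
    apply kk_pos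
    simp at hw; linarith
  have hq : ContinuousOn (fun w : E m => ‖fderiv ℝ (kk (R / 2)) w‖ / kk R w) (closedBall 0 (R / 2)) :=
    hc.norm.continuousOn.div (kk_contDiff R).continuous.continuousOn fun w hw => (hpos w hw).ne'
  obtain ⟨C, hC⟩ := hcomp.exists_bound_of_continuousOn hq
  refine ⟨max C 0, le_max_right _ _, fun w => ?_⟩
  by_cases hw : w ∈ closedBall (0 : E m) (R / 2)
  · have := hC w hw
    rw [Real.norm_of_nonneg (div_nonneg (norm_nonneg _) (kk_nonneg _ _)), div_le_iff₀ (hpos w hw)] at this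
    exact this.trans (mul_le_mul_of_nonneg_right (le_max_left _ _) (kk_nonneg _ _))
  · have : fderiv ℝ (kk (R / 2)) w = 0 := by
      by_contra h
      exact hw (kk_tsupport hR2 (support_fderiv_subset ℝ h))
    rw [this, norm_zero]
    exact mul_nonneg (le_max_right _ _) (kk_nonneg _ _)

theorem cut_mvp {U : Set (E m)} (hU : IsOpen U) {f : E m → ℝ} (hf : HarmOn U f) {x : E m} {R : ℝ}
    (hsub : closedBall x (2 * R) ⊆ U) {χ : E m → ℝ} (hχ : ContDiff ℝ 2 χ)
    (h1 : ∀ y ∈ ball x R, χ y = 1) (hs : tsupport χ ⊆ closedBall x (2 * R)) {y : E m} {r : ℝ}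
    (hr : 0 < r) (hy : ball y r ⊆ ball x R) :
    cv (fun y => χ y * f y) (kk r) y = f y * ∫ w : E m, kk r w := by
  rw [mvp_cv (cut_contDiff hU hχ (hs.trans hsub) hf.1) y hr, h1 y (hy (mem_ball_self hr)), one_mul]
  intro z hz
  have hzx := hy hz
  rw [lap_congr (cut_eq h1 hzx)]
  apply hf.2 _ (hsub _)
  have : dist z x < R := hzx
  have := dist_nonneg (x := z) (y := x)
  rw [mem_closedBall]; linarith

/-- gradient estimate for nonnegative harmonic functions -/
theorem grad_est (m : ℕ) {R : ℝ} (hR : 0 < R) : ∃ C : ℝ, 0 < C ∧ ∀ (U : Set (E m)), IsOpen U →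
    ∀ f : E m → ℝ, HarmOn U f → ∀ x, closedBall x (2 * R) ⊆ U →
    (∀ y ∈ closedBall x (2 * R), 0 ≤ f y) → ‖fderiv ℝ f x‖ ≤ C * f x := by
  obtain ⟨C, hC0, hC⟩ := kernel_bound (m := m) hR
  have hR2 : 0 < R / 2 := by linarith
  set c1 := ∫ w : E m, kk (R / 2) w with hc1
  set c2 := ∫ w : E m, kk R w with hc2
  have p1 : 0 < c1 := kk_int_pos hR2
  have p2 : 0 < c2 := kk_int_pos hR
  refine ⟨C * c2 / c1 + 1, by positivity, ?_⟩
  intro U hU f hf x hsub hpos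
  obtain ⟨χ, hχ, hχ0, hχ1, h1, hs⟩ := exists_cut x hR
  have hxs : x ∈ closedBall x (2 * R) := mem_closedBall_self (by linarith)
  have hF0 : ∀ y, 0 ≤ χ y * f y := by
    intro y
    by_cases hy : y ∈ closedBall x (2 * R)
    · exact mul_nonneg (hχ0 y) (hpos y hy)
    · rw [image_eq_zero_of_notMem_tsupport (fun h => hy (hs h)), zero_mul]
  have hFc : Continuous (fun y => χ y * f y) := (cut_contDiff hU hχ (hs.trans hsub) hf.1).continuous
  have hev : cv (fun y => χ y * f y) (kk (R / 2)) =ᶠ[𝓝 x] fun y => f y * c1 := by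
    filter_upwards [ball_mem_nhds x hR2] with y hy
    apply cut_mvp hU hf hsub hχ h1 hs hR2
    intro z hz
    rw [mem_ball] at *
    linarith [dist_triangle z y x]
  have hx : cv (fun y => χ y * f y) (kk R) x = f x * c2 := 
    cut_mvp hU hf hsub hχ h1 hs hR le_rfl
  have hfd : DifferentiableAt ℝ f x :=
    (hf.1.contDiffAt (hU.mem_nhds (hsub hxs))).differentiableAt (by norm_num)
  have hkey : ∀ v, ‖fderiv ℝ f x v‖ * c1 ≤ C * (f x * c2) * ‖v‖ := by
    intro v
    have e := cv_fderiv hFc ((kk_contDiff (R / 2)).of_le (by norm_num)) (kk_hcs hR2) x v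
    rw [hev.fderiv_eq, fderiv_mul_const hfd] at e
    have e' : ‖fderiv ℝ f x v‖ * c1 = ‖cv (fun y => χ y * f y) (fun y => fderiv ℝ (kk (R / 2)) y v) x‖ := by
      rw [← e]; simp [abs_of_pos p1, mul_comm]
    rw [e', ← hx]
    unfold cv
    rw [mul_right_comm, ← integral_const_mul]
    have hint : Integrable (fun y => (C * ‖v‖) * (χ y * f y * kk R (x - y))) := by
      apply Integrable.const_mul
      apply Continuous.integrable_of_hasCompactSupport
      · exact hFc.mul ((kk_contDiff R).continuous.comp (by fun_prop))
      · exact ((kk_hcs hR).comp_homeomorph (Homeomorph.subLeft x)).mul_left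
    refine norm_integral_le_of_norm_le hint (Eventually.of_forall fun y => ?_)
    rw [norm_mul, Real.norm_of_nonneg (hF0 y)]
    have := ((fderiv ℝ (kk (R / 2)) (x - y)).le_opNorm v).trans
      (mul_le_mul_of_nonneg_right (hC (x - y)) (norm_nonneg v))
    calc _ ≤ χ y * f y * (C * kk R (x - y) * ‖v‖) := mul_le_mul_of_nonneg_left this (hF0 y)
      _ = _ := by ring
  have hfx := hpos x hxs
  apply ContinuousLinearMap.opNorm_le_bound _ (by positivity)
  intro v
  have h2 := hkey v
  have : ‖fderiv ℝ f x v‖ ≤ C * (f x * c2) * ‖v‖ / c1 := by rwa [le_div_iff₀ p1]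
  calc _ ≤ _ := this
    _ = C * c2 / c1 * f x * ‖v‖ := by field_simp
    _ ≤ _ := by gcongr; linarith

/-- Limits of harmonic functions -/
theorem harm_limit {U : Set (E m)} (hU : IsOpen U) {f : ℕ → E m → ℝ} (hf : ∀ n, HarmOn U (f n))
    {g : E m → ℝ} (hg : ContinuousOn g U)
    (hlim : ∀ x ∈ U, Tendsto (fun n => f n x) atTop (𝓝 (g x)))
    (hb : ∀ K ⊆ U, IsCompact K → ∃ M : ℝ, ∀ᶠ n in atTop, ∀ x ∈ K, |f n x| ≤ M) :
    HarmOn U g := by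
  have main : ∀ x ∈ U, ContDiffAt ℝ 2 g x ∧ lap g x = 0 := by
    intro x hx
    obtain ⟨r, hr, hrU⟩ := Metric.isOpen_iff.1 hU x hx
    obtain ⟨R, hR, hsub⟩ : ∃ R > 0, closedBall x (2 * R) ⊆ U :=
      ⟨r / 4, by linarith, (closedBall_subset_ball (by linarith)).trans hrU⟩
    have hR2 : 0 < R / 2 := by linarith
    obtain ⟨χ, hχ, hχ0, hχ1, h1, hs⟩ := exists_cut x hR
    obtain ⟨M, hM⟩ := hb _ hsub (isCompact_closedBall _ _)
    set c1 := ∫ w : E m, kk (R / 2) w with hc1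
    have p1 : 0 < c1 := kk_int_pos hR2
    have hGc : Continuous (fun y => χ y * g y) := cut_cont hU hχ.continuous (hs.trans hsub) hg
    have hFc : ∀ n, Continuous (fun y => χ y * f n y) := fun n =>
      cut_cont hU hχ.continuous (hs.trans hsub) (hf n).1.continuousOn
    have hM0 : ∀ᶠ n in atTop, ∀ y, |χ y * f n y| ≤ M := by
      filter_upwards [hM] with n hn y
      have hMn : 0 ≤ M := (abs_nonneg _).trans (hn x (mem_closedBall_self (by linarith)))
      by_cases hy : y ∈ closedBall x (2 * R)
      · rw [abs_mul, abs_of_nonneg (hχ0 y)]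
        nlinarith [hn y hy, hχ0 y, hχ1 y, abs_nonneg (f n y)]
      · rw [image_eq_zero_of_notMem_tsupport (fun h => hy (hs h)), zero_mul, abs_zero]
        exact hMn
    have hpt : ∀ y, Tendsto (fun n => χ y * f n y) atTop (𝓝 (χ y * g y)) := by
      intro y
      by_cases hy : y ∈ closedBall x (2 * R)
      · exact (hlim y (hsub hy)).const_mul _
      · rw [image_eq_zero_of_notMem_tsupport (fun h => hy (hs h))]; simp
    have hcvlim : ∀ k : E m → ℝ, Continuous k → HasCompactSupport k → ∀ y,
        Tendsto (fun n => cv (fun y => χ y * f n y) k y) atTop (𝓝 (cv (fun y => χ y * g y) k y)) := by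
      intro k hk hkc y
      have hky : Continuous (fun z => k (y - z)) := hk.comp (by fun_prop)
      apply tendsto_integral_filter_of_dominated_convergence (fun z => M * |k (y - z)|)
      · exact Eventually.of_forall fun n => ((hFc n).mul hky).aestronglyMeasurable
      · filter_upwards [hM0] with n hn
        refine Eventually.of_forall fun z => ?_
        rw [norm_mul]
        exact mul_le_mul_of_nonneg_right (hn z) (norm_nonneg _)
      · apply Integrable.const_mul
        exact (hky.integrable_of_hasCompactSupport
          (hkc.comp_homeomorph (Homeomorph.subLeft y))).norm
      · exact Eventually.of_forall fun z => (hpt z).mul_const _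
    have hk2 : ContDiff ℝ 2 (kk (R / 2) : E m → ℝ) := kk_contDiff _
    have hkc : HasCompactSupport (kk (R / 2) : E m → ℝ) := kk_hcs hR2
    have hevn : ∀ n, ∀ y ∈ ball x (R / 2), cv (fun y => χ y * f n y) (kk (R / 2)) y = f n y * c1 := by
      intro n y hy
      apply cut_mvp hU (hf n) hsub hχ h1 hs hR2
      intro z hz
      rw [mem_ball] at *
      linarith [dist_triangle z y x]
    have hev : ∀ y ∈ ball x (R / 2), cv (fun y => χ y * g y) (kk (R / 2)) y = g y * c1 := by
      intro y hy
      have hyU : y ∈ U := hsub (by rw [mem_ball] at hy; rw [mem_closedBall]; linarith)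
      refine tendsto_nhds_unique (hcvlim _ hk2.continuous hkc y) ?_
      simp_rw [hevn _ y hy]
      exact (hlim y hyU).mul_const _
    have hevg : g =ᶠ[𝓝 x] fun y => c1⁻¹ * cv (fun y => χ y * g y) (kk (R / 2)) y := by
      filter_upwards [ball_mem_nhds x hR2] with y hy
      rw [hev y hy]; field_simp
    have hcd := cv_contDiff hGc hk2 hkc
    refine ⟨((contDiff_const.mul hcd).contDiffAt).congr_of_eventuallyEq hevg, ?_⟩
    have lap_mul : ∀ (c : ℝ) (F : E m → ℝ), ContDiff ℝ 2 F → lap (fun y => c * F y) x = c * lap F x := by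
      intro c F hF
      have hF1 : ContDiff ℝ 1 (fderiv ℝ F) := hF.fderiv_right (by norm_num)
      have hFv : ∀ v, ContDiff ℝ 1 (fun y => fderiv ℝ F y v) := fun v => hF1.clm_apply contDiff_const
      unfold lap
      rw [Finset.mul_sum]
      refine Finset.sum_congr rfl fun i _ => ?_
      have : (fun y => fderiv ℝ (fun y => c * F y) y (EuclideanSpace.single i 1)) =
          fun y => c * fderiv ℝ F y (EuclideanSpace.single i 1) := by
        funext y
        rw [fderiv_const_mul (hF.differentiable (by norm_num) y)]; simp
      rw [this, fderiv_const_mul ((hFv _).differentiable (by norm_num) x)]; simp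
    rw [lap_congr hevg, lap_mul _ _ hcd, cv_lap hGc hk2 hkc]
    have hlc : HasCompactSupport (lap (kk (R / 2) : E m → ℝ)) := by
      refine HasCompactSupport.intro hkc fun z hz => ?_
      have : (kk (R / 2) : E m → ℝ) =ᶠ[𝓝 z] fun _ => 0 := by
        filter_upwards [(isClosed_tsupport _).isOpen_compl.mem_nhds hz] with y hy
        exact image_eq_zero_of_notMem_tsupport hy
      rw [lap_congr this]
      simp [lap]
    have hz : ∀ n, cv (fun y => χ y * f n y) (lap (kk (R / 2))) x = 0 := by
      intro n
      rw [← cv_lap (hFc n) hk2 hkc]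
      have : cv (fun y => χ y * f n y) (kk (R / 2)) =ᶠ[𝓝 x] fun y => c1 * (χ y * f n y) := by
        filter_upwards [ball_mem_nhds x hR2] with y hy
        rw [hevn n y hy, h1 y (ball_subset_ball (by linarith) hy)]; ring
      rw [lap_congr this, lap_mul _ _ (cut_contDiff hU hχ (hs.trans hsub) (hf n).1),
        lap_congr (cut_eq h1 (mem_ball_self hR)), (hf n).2 x hx, mul_zero]
    have := hcvlim _ (lap_continuous hk2) hlc x
    simp_rw [hz] at this
    rw [tendsto_nhds_unique this tendsto_const_nhds, mul_zero]
  exact ⟨fun x hx => (main x hx).1.contDiffWithinAt, fun x hx => (main x hx).2⟩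

/-- the function `S` on the reals -/
def sr (r : ℝ) : ℝ := Real.arctan (Real.sinh r)

/-- its inverse -/
def rs (s : ℝ) : ℝ := Real.arsinh (Real.tan s)

theorem SF_coe (r : ℝ) : SF ((r : ℝ) : EReal) = sr r := by
  simp [SF, sr]

theorem SF_top : SF ⊤ = Real.pi / 2 := by simp [SF]

theorem SF_bot : SF ⊥ = -(Real.pi / 2) := by simp [SF]

theorem sr_strictMono : StrictMono sr := Real.arctan_strictMono.comp Real.sinh_strictMono

theorem sr_neg (r : ℝ) : sr (-r) = - sr r := by simp [sr]

theorem sr_zero : sr 0 = 0 := by simp [sr]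

theorem sr_abs_lt (r : ℝ) : |sr r| < Real.pi / 2 :=
  abs_lt.2 ⟨Real.neg_pi_div_two_lt_arctan _, Real.arctan_lt_pi_div_two _⟩

theorem sr_hasDerivAt (r : ℝ) : HasDerivAt sr (1 / Real.cosh r) r := by
  have := (Real.hasDerivAt_sinh r).arctan
  convert! this using 1
  have h := Real.cosh_pos r
  rw [← Real.cosh_sq', ]
  field_simp

theorem sr_continuous : Continuous sr :=
  continuous_iff_continuousAt.2 fun r => (sr_hasDerivAt r).continuousAt

theorem rs_sr (r : ℝ) : rs (sr r) = r := by simp [rs, sr, Real.tan_arctan]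

theorem sr_rs {s : ℝ} (h : |s| < Real.pi / 2) : sr (rs s) = s := by
  rw [abs_lt] at h
  simp [rs, sr, Real.sinh_arsinh, Real.arctan_tan h.1 h.2]

theorem rs_continuousAt {s : ℝ} (h : |s| < Real.pi / 2) : ContinuousAt rs s := by
  rw [abs_lt] at h
  have : Real.cos s ≠ 0 := (Real.cos_pos_of_mem_Ioo ⟨h.1, h.2⟩).ne'
  exact (Real.continuous_arsinh.continuousAt).comp (Real.continuousAt_tan.2 this)

theorem abs_le_of_sr {r b : ℝ} (hb : |b| < Real.pi / 2) (h : |sr r| < b) : |r| ≤ rs b := by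
  rw [abs_lt] at h
  rw [abs_le]
  constructor
  · have : sr (-r) < sr (rs b) := by rw [sr_neg, sr_rs hb]; linarith
    linarith [sr_strictMono.lt_iff_lt.1 this]
  · have : sr r < sr (rs b) := by rw [sr_rs hb]; linarith
    exact (sr_strictMono.lt_iff_lt.1 this).le

theorem tilde_eq (f : E m → ℝ) (x : E m) : tilde f x = ‖fderiv ℝ f x‖ / Real.cosh (f x) := by
  simp [tilde, gradient]

theorem tilde_neg (f : E m → ℝ) (x : E m) : tilde (fun x => - f x) x = tilde f x := by
  rw [tilde_eq, tilde_eq, fderiv_fun_neg, norm_neg, Real.cosh_neg]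

/-- uniform convergence on compact subsets of `U` -/
def TC (U : Set (E m)) (u : ℕ → E m → ℝ) (G : E m → ℝ) : Prop :=
  ∀ K ⊆ U, IsCompact K → ∀ ε > 0, ∃ N : ℕ, ∀ n ≥ N, ∀ x ∈ K, |u n x - G x| < ε

theorem TC.tendsto {U : Set (E m)} {u : ℕ → E m → ℝ} {G : E m → ℝ} (h : TC U u G) {x : E m}
    (hx : x ∈ U) : Tendsto (fun n => u n x) atTop (𝓝 (G x)) := by
  rw [Metric.tendsto_atTop]
  intro ε hε
  obtain ⟨N, hN⟩ := h {x} (by simpa using hx) isCompact_singleton ε hε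
  exact ⟨N, fun n hn => hN n hn x rfl⟩

theorem TC.bdd {U : Set (E m)} {f : ℕ → E m → ℝ} {G : E m → ℝ} (h : TC U (fun n x => sr (f n x)) G)
    {K : Set (E m)} (hKU : K ⊆ U) (hK : IsCompact K) (hG : ContinuousOn G K)
    (hlt : ∀ x ∈ K, |G x| < Real.pi / 2) : ∃ M : ℝ, ∀ᶠ n in atTop, ∀ x ∈ K, |f n x| ≤ M := by
  rcases K.eq_empty_or_nonempty with rfl | hne
  · exact ⟨0, by simp⟩
  obtain ⟨x0, hx0, hmax⟩ := hK.exists_isMaxOn hne hG.abs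
  have ha := hlt x0 hx0
  have ha0 := abs_nonneg (G x0)
  set a := |G x0|
  obtain ⟨N, hN⟩ := h K hKU hK ((Real.pi / 2 - a) / 2) (by linarith)
  refine ⟨rs ((a + Real.pi / 2) / 2), ?_⟩
  filter_upwards [eventually_ge_atTop N] with n hn x hx
  apply abs_le_of_sr
  · rw [abs_of_nonneg (by linarith)]; linarith
  · have h1 := hN n hn x hx
    have h2 : |G x| ≤ a := hmax hx
    have h3 := abs_add_le (sr (f n x) - G x) (G x)
    rw [sub_add_cancel] at h3
    linarith

/-- Arzela-Ascoli -/
theorem ascoli {X : Type*} [MetricSpace X] [LocallyCompactSpace X] [SigmaCompactSpace X]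
    (u : ℕ → X → ℝ) (B : ℝ) (hB : ∀ n x, |u n x| ≤ B)
    (hl : ∀ x, ∃ r > 0, ∃ M : ℝ, ∀ n, ∀ y ∈ ball x r, ∀ z ∈ ball x r,
      |u n y - u n z| ≤ M * dist y z) :
    ∃ φ : ℕ → ℕ, StrictMono φ ∧ ∃ G : C(X, ℝ), ∀ K : Set X, IsCompact K →
      TendstoUniformlyOn (fun n => u (φ n)) G atTop K := by
  choose r hr M hM using hl
  let T : Set (X → ℝ) := {h | (∀ x, h x ∈ Set.Icc (-B) B) ∧ ∀ x, ∀ y ∈ ball x (r x), ∀ z ∈ ball x (r x),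
      |h y - h z| ≤ M x * dist y z}
  have hTt : ∀ x, ∀ ε > 0, ∃ δ > 0, ∀ h ∈ T, ∀ y, dist y x < δ → |h x - h y| < ε := by
    intro x ε hε
    refine ⟨min (r x) (ε / (|M x| + 1)), lt_min (hr x) (by positivity), fun h hh y hy => ?_⟩
    have h1 := hh.2 x x (mem_ball_self (hr x)) y (hy.trans_le (min_le_left _ _))
    have h2 : dist y x < ε / (|M x| + 1) := hy.trans_le (min_le_right _ _)
    rw [lt_div_iff₀ (by positivity)] at h2
    rw [dist_comm] at h1
    have := le_abs_self (M x)
    nlinarith [dist_nonneg (x := y) (y := x)]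
  have hTc : ∀ h ∈ T, Continuous h := by
    intro h hh
    rw [Metric.continuous_iff]
    intro x ε hε
    obtain ⟨δ, hδ, H⟩ := hTt x ε hε
    refine ⟨δ, hδ, fun y hy => ?_⟩
    rw [dist_comm]
    exact H h hh y hy
  have hTcl : IsClosed T := by
    have : T = (⋂ x, {h : X → ℝ | h x ∈ Set.Icc (-B) B}) ∩ ⋂ x, ⋂ y ∈ ball x (r x), ⋂ z ∈ ball x (r x),
        {h : X → ℝ | |h y - h z| ≤ M x * dist y z} := by
      ext h; simp [T]
    rw [this]
    refine (isClosed_iInter fun x => isClosed_Icc.preimage (continuous_apply x)).inter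
      (isClosed_iInter fun x => isClosed_biInter fun y _ => isClosed_biInter fun z _ => ?_)
    exact isClosed_le (((continuous_apply y).sub (continuous_apply z)).abs) continuous_const
  have hTk : IsCompact T := by
    refine (isCompact_univ_pi (fun _ : X => isCompact_Icc (a := -B) (b := B))).of_isClosed_subset hTcl ?_
    intro h hh x _
    exact hh.1 x
  let S : Set C(X, ℝ) := {g | (g : X → ℝ) ∈ T}
  have hS : IsCompact S := by
    apply ArzelaAscoli.isCompact_of_equicontinuous
    · convert! hTk
      ext h
      constructor
      · rintro ⟨g, hg, rfl⟩; exact hg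
      · intro hh; exact ⟨⟨h, hTc h hh⟩, hh, rfl⟩
    · intro x
      rw [Metric.equicontinuousAt_iff]
      intro ε hε
      obtain ⟨δ, hδ, H⟩ := hTt x ε hε
      exact ⟨δ, hδ, fun y hy g => H _ g.2 y hy⟩
  have huT : ∀ n, u n ∈ T := fun n => ⟨fun x => abs_le.1 (hB n x), fun x y hy z hz => hM x n y hy z hz⟩
  obtain ⟨G, -, φ, hφ, hlim⟩ := hS.tendsto_subseq (x := fun n => ⟨u n, hTc _ (huT n)⟩) huT
  refine ⟨φ, hφ, G, fun K hK => ?_⟩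
  exact ContinuousMap.tendsto_iff_forall_isCompact_tendstoUniformlyOn.1 hlim K hK

theorem harnack {U : Set (E m)} (hU : IsOpen U) {x : E m} {R : ℝ} (hR : 0 < R)
    (hsub : closedBall x (3 * R) ⊆ U) : ∃ c > 0, ∀ f : E m → ℝ, HarmOn U f →
    (∀ y ∈ closedBall x (3 * R), 0 < f y) → ∀ y ∈ ball x R, c * f x ≤ f y := by
  obtain ⟨C, hC, H⟩ := grad_est m hR
  refine ⟨Real.exp (-(C * R)), Real.exp_pos _, fun f hf hpos y hy => ?_⟩
  have hin : ∀ z ∈ ball x R, closedBall z (2 * R) ⊆ closedBall x (3 * R) := by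
    intro z hz w hw
    rw [mem_ball] at hz
    rw [mem_closedBall] at *
    linarith [dist_triangle w z x]
  have hself : ∀ z ∈ ball x R, z ∈ closedBall x (3 * R) := fun z hz =>
    hin z hz (mem_closedBall_self (by linarith))
  have hd : ∀ z ∈ ball x R, DifferentiableAt ℝ f z := fun z hz =>
    (hf.1.contDiffAt (hU.mem_nhds (hsub (hself z hz)))).differentiableAt (by norm_num)
  have hlog : ∀ z ∈ ball x R, ‖fderiv ℝ (fun z => Real.log (f z)) z‖ ≤ C := by
    intro z hz
    have hp := hpos z (hself z hz)
    rw [fderiv.log (hd z hz) hp.ne', norm_smul, norm_inv, Real.norm_of_nonneg hp.le,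
      inv_mul_le_iff₀ hp, mul_comm]
    exact H U hU f hf z ((hin z hz).trans hsub) fun w hw => (hpos w (hin z hz hw)).le
  have hx := mem_ball_self (x := x) hR
  have h1 := (convex_ball x R).norm_image_sub_le_of_norm_fderiv_le (𝕜 := ℝ)
    (fun z hz => (hd z hz).log (hpos z (hself z hz)).ne') hlog hx hy
  have h2 : ‖y - x‖ < R := by rwa [← mem_ball_iff_norm]
  have h3 := (abs_le.1 h1).1
  have h4 : C * ‖y - x‖ ≤ C * R := by gcongr
  have px := hpos x (hself x hx)
  have py := hpos y (hself y hy)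
  rw [← Real.exp_log px, ← Real.exp_add, ← Real.exp_log py, Real.exp_le_exp]
  linarith

theorem open_top {U : Set (E m)} (hU : IsOpen U) {f : ℕ → E m → ℝ} (hf : ∀ n, HarmOn U (f n))
    {G : E m → ℝ} (hG : ContinuousOn G U) (h : TC U (fun n x => sr (f n x)) G) :
    IsOpen {x | x ∈ U ∧ G x = Real.pi / 2} := by
  rw [Metric.isOpen_iff]
  rintro x ⟨hx, hGx⟩
  have hGc : ContinuousAt G x := hG.continuousAt (hU.mem_nhds hx)
  have : {y | y ∈ U ∧ Real.pi / 4 < G y} ∈ 𝓝 x := by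
    filter_upwards [hU.mem_nhds hx, hGc.eventually (lt_mem_nhds (a := Real.pi / 4) (by
      rw [hGx]; linarith [Real.pi_pos]))] with y h1 h2 using ⟨h1, h2⟩
  obtain ⟨r, hr, hrs⟩ := Metric.mem_nhds_iff.1 this
  have hR : 0 < r / 4 := by linarith
  have hsub' : closedBall x (3 * (r / 4)) ⊆ ball x r := closedBall_subset_ball (by linarith)
  have hsub : closedBall x (3 * (r / 4)) ⊆ U := fun y hy => (hrs (hsub' hy)).1
  obtain ⟨c, hc, H⟩ := harnack hU hR hsub
  refine ⟨r / 4, hR, fun y hy => ?_⟩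
  have hyU : y ∈ U := hsub (by rw [mem_ball] at hy; rw [mem_closedBall]; linarith)
  refine ⟨hyU, ?_⟩
  obtain ⟨N, hN⟩ := h _ hsub (isCompact_closedBall _ _) (Real.pi / 4) (by linarith [Real.pi_pos])
  by_contra hne
  have hle : |G y| ≤ Real.pi / 2 :=
    le_of_tendsto (h.tendsto hyU).abs (Eventually.of_forall fun n => (sr_abs_lt _).le)
  have hltG : |G y| < Real.pi / 2 := by
    have h1 := (hrs (ball_subset_ball (by linarith) hy)).2
    have h0 : 0 < G y := by linarith [Real.pi_pos]
    rw [abs_of_pos h0] at hle ⊢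
    exact lt_of_le_of_ne hle hne
  -- `f n y` stays bounded, hence so does `f n x`
  have hylim : Tendsto (fun n => f n y) atTop (𝓝 (rs (G y))) := by
    have := (rs_continuousAt hltG).tendsto.comp (h.tendsto hyU)
    simpa [Function.comp_def, rs_sr] using this
  obtain ⟨A, hA⟩ : ∃ A : ℝ, ∀ᶠ n in atTop, f n y < A :=
    ⟨rs (G y) + 1, hylim.eventually_lt_const (by linarith)⟩
  have hev : ∀ᶠ n in atTop, sr (f n x) ≤ sr (A / c) := by
    filter_upwards [hA, eventually_ge_atTop N] with n h1 h2
    have hpos : ∀ z ∈ closedBall x (3 * (r / 4)), 0 < f n z := by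
      intro z hz
      have h3 := (abs_lt.1 (hN n h2 z hz)).1
      have h4 := (hrs (hsub' hz)).2
      have : sr 0 < sr (f n z) := by rw [sr_zero]; linarith
      exact sr_strictMono.lt_iff_lt.1 this
    have h3 := H (f n) (hf n) hpos y hy
    apply sr_strictMono.monotone
    rw [le_div_iff₀ hc]; linarith
  have := le_of_tendsto (h.tendsto hx) hev
  rw [hGx] at this
  linarith [(abs_lt.1 (sr_abs_lt (A / c))).2]

theorem top_or {U : Set (E m)} (hU : IsOpen U) (hUc : IsConnected U) {f : ℕ → E m → ℝ}
    (hf : ∀ n, HarmOn U (f n))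
    {G : E m → ℝ} (hG : ContinuousOn G U) (h : TC U (fun n x => sr (f n x)) G) :
    (∀ x ∈ U, G x = Real.pi / 2) ∨ (∀ x ∈ U, G x ≠ Real.pi / 2) := by
  by_cases hex : ∃ x ∈ U, G x = Real.pi / 2
  · left
    obtain ⟨x, hx, hGx⟩ := hex
    have h2 : IsOpen (U ∩ G ⁻¹' {Real.pi / 2}ᶜ) := hG.isOpen_inter_preimage hU isOpen_compl_singleton
    have := hUc.isPreconnected.subset_left_of_subset_union (open_top hU hf hG h) h2 (by
      rw [Set.disjoint_left]
      rintro y ⟨_, h1⟩ ⟨_, h3⟩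
      exact h3 h1) (fun y hy => by
        by_cases hh : G y = Real.pi / 2
        · exact Or.inl ⟨hy, hh⟩
        · exact Or.inr ⟨hy, hh⟩) ⟨x, hx, hx, hGx⟩
    exact fun y hy => (this hy).2
  · right
    push Not at hex
    exact hex

theorem le_cosh (t : ℝ) : t ≤ Real.cosh t := by
  have h1 := Real.self_le_sinh_iff (x := t)
  rcases le_total 0 t with h | h
  · exact (h1.2 h).trans (Real.sinh_lt_cosh t).le
  · exact h.trans (Real.cosh_pos t).le

theorem equi {U : Set (E m)} (hUo : IsOpen U) {Fam : Set (E m → ℝ)}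
    (hFam : ∀ f ∈ Fam, HarmOn U f)
    (H : ∀ K ⊆ U, IsCompact K → ∃ M : ℝ, 0 < M ∧ ∀ f ∈ Fam, ∀ x ∈ K, tilde f x ≤ M)
    {x : E m} (hx : x ∈ U) : ∃ r > 0, ∃ M : ℝ, ∀ f ∈ Fam, ∀ y ∈ ball x r, ∀ z ∈ ball x r,
      |sr (f y) - sr (f z)| ≤ M * dist y z := by
  obtain ⟨r, hr, hrU⟩ := Metric.isOpen_iff.1 hUo x hx
  have hsub : closedBall x (r / 2) ⊆ U := (closedBall_subset_ball (by linarith)).trans hrU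
  obtain ⟨M, -, hM⟩ := H _ hsub (isCompact_closedBall _ _)
  refine ⟨r / 2, by linarith, M, fun f hf y hy z hz => ?_⟩
  have hd : ∀ w ∈ ball x (r / 2), HasFDerivAt (fun w => sr (f w))
      ((1 / Real.cosh (f w)) • fderiv ℝ f w) w := by
    intro w hw
    have : DifferentiableAt ℝ f w := ((hFam f hf).1.contDiffAt
      (hUo.mem_nhds (hsub (ball_subset_closedBall hw)))).differentiableAt (by norm_num)
    exact (sr_hasDerivAt (f w)).comp_hasFDerivAt w this.hasFDerivAt
  have := (convex_ball x (r / 2)).norm_image_sub_le_of_norm_hasFDerivWithin_le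
    (fun w hw => (hd w hw).hasFDerivWithinAt) (C := M) (fun w hw => by
      have := hM f hf w (ball_subset_closedBall hw)
      rw [tilde_eq] at this
      rw [norm_smul, Real.norm_of_nonneg (by have := Real.cosh_pos (f w); positivity)]
      rw [one_div, inv_mul_eq_div]; exact this) hz hy
  rwa [← dist_eq_norm y z] at this

theorem backward {U : Set (E m)} (hUo : IsOpen U) (hUc : IsConnected U)
    {Fam : Set (E m → ℝ)} (hFam : ∀ f ∈ Fam, HarmOn U f)
    (H : ∀ K ⊆ U, IsCompact K → ∃ M : ℝ, 0 < M ∧ ∀ f ∈ Fam, ∀ x ∈ K, tilde f x ≤ M) :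
    NormalFam U Fam := by
  intro f hf
  have : LocallyCompactSpace U := hUo.locallyCompactSpace
  obtain ⟨φ, hφ, G0, hG0⟩ := ascoli (X := U) (fun n x => sr (f n x)) (Real.pi / 2)
    (fun n x => (sr_abs_lt _).le) (by
      rintro ⟨x, hx⟩
      obtain ⟨r, hr, M, hM⟩ := equi hUo hFam H hx
      exact ⟨r, hr, M, fun n y hy z hz => hM _ (hf n) y hy z hz⟩)
  refine ⟨φ, hφ, ?_⟩
  classical
  let G : E m → ℝ := fun x => if hx : x ∈ U then G0 ⟨x, hx⟩ else 0
  have hGe : ∀ x (hx : x ∈ U), G x = G0 ⟨x, hx⟩ := fun x hx => by simp [G, hx]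
  have hGc : ContinuousOn G U := by
    rw [continuousOn_iff_continuous_domRestrict]
    convert! G0.continuous using 1
    funext x
    exact hGe x x.2
  have hTC : TC U (fun n x => sr (f (φ n) x)) G := by
    intro K hKU hK ε hε
    have hK' : IsCompact ((↑) ⁻¹' K : Set U) := by
      rw [Subtype.isCompact_iff, Subtype.image_preimage_coe, Set.inter_eq_right.2 hKU]
      exact hK
    have := Metric.tendstoUniformlyOn_iff.1 (hG0 _ hK') ε hε
    obtain ⟨N, hN⟩ := eventually_atTop.1 this
    refine ⟨N, fun n hn x hx => ?_⟩
    have := hN n hn ⟨x, hKU hx⟩ hx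
    rw [dist_comm, Real.dist_eq] at this
    rw [hGe x (hKU hx)]
    exact this
  have hh : ∀ n, HarmOn U (f (φ n)) := fun n => hFam _ (hf _)
  have hle : ∀ x ∈ U, |G x| ≤ Real.pi / 2 := fun x hx =>
    le_of_tendsto (hTC.tendsto hx).abs (Eventually.of_forall fun n => (sr_abs_lt _).le)
  rcases top_or hUo hUc hh hGc hTC with h1 | h1
  · right; left
    intro K hKU hK ε hε
    obtain ⟨N, hN⟩ := hTC K hKU hK ε hε
    refine ⟨N, fun n hn x hx => ?_⟩
    have := hN n hn x hx
    rw [h1 x (hKU hx)] at this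
    rwa [SF_coe, SF_top]
  have hTC' : TC U (fun n x => sr (- f (φ n) x)) (fun x => - G x) := by
    intro K hKU hK ε hε
    obtain ⟨N, hN⟩ := hTC K hKU hK ε hε
    refine ⟨N, fun n hn x hx => ?_⟩
    have := hN n hn x hx
    simp only [sr_neg]
    rw [← abs_neg]
    convert this using 2
    ring
  rcases top_or (G := fun x => - G x) hUo hUc (fun n => (hh n).neg) hGc.neg hTC' with h2 | h2
  · right; right
    intro K hKU hK ε hε
    obtain ⟨N, hN⟩ := hTC K hKU hK ε hε
    refine ⟨N, fun n hn x hx => ?_⟩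
    have := hN n hn x hx
    rw [show G x = -(Real.pi / 2) by linarith [h2 x (hKU hx)]] at this
    rwa [SF_coe, SF_bot]
  left
  have hlt : ∀ x ∈ U, |G x| < Real.pi / 2 := by
    intro x hx
    have h3 := abs_le.1 (hle x hx)
    rw [abs_lt]
    exact ⟨lt_of_le_of_ne h3.1 fun h => h2 x hx (by linarith), lt_of_le_of_ne h3.2 (h1 x hx)⟩
  refine ⟨fun x => rs (G x), ?_, ?_⟩
  · apply harm_limit hUo hh
    · intro x hx
      exact (rs_continuousAt (hlt x hx)).comp_continuousWithinAt (hGc x hx)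
    · intro x hx
      have := (rs_continuousAt (hlt x hx)).tendsto.comp (hTC.tendsto hx)
      simpa [Function.comp_def, rs_sr] using this
    · intro K hKU hK
      exact hTC.bdd hKU hK (hGc.mono hKU) fun x hx => hlt x (hKU hx)
  · intro K hKU hK ε hε
    obtain ⟨N, hN⟩ := hTC K hKU hK ε hε
    refine ⟨N, fun n hn x hx => ?_⟩
    rw [SF_coe, SF_coe, sr_rs (hlt x (hKU hx))]
    exact hN n hn x hx

theorem tilde_pos_case (m : ℕ) {R : ℝ} (hR : 0 < R) : ∃ C : ℝ, 0 < C ∧ ∀ (U : Set (E m)), IsOpen U →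
    ∀ f : E m → ℝ, HarmOn U f → ∀ x, closedBall x (2 * R) ⊆ U →
    (∀ y ∈ closedBall x (2 * R), 0 ≤ f y) → tilde f x ≤ C := by
  obtain ⟨C, hC, H⟩ := grad_est m hR
  refine ⟨C, hC, fun U hU f hf x hsub hpos => ?_⟩
  rw [tilde_eq, div_le_iff₀ (Real.cosh_pos _)]
  exact (H U hU f hf x hsub hpos).trans (by gcongr; exact le_cosh _)

theorem forward {U : Set (E m)} (hUo : IsOpen U) 
    {Fam : Set (E m → ℝ)} (hFam : ∀ f ∈ Fam, HarmOn U f) (hN : NormalFam U Fam) :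
    ∀ K ⊆ U, IsCompact K → ∃ M : ℝ, 0 < M ∧ ∀ f ∈ Fam, ∀ x ∈ K, tilde f x ≤ M := by
  intro K hKU hK
  by_contra hcon
  push Not at hcon
  choose f hf x hx hbig using fun n : ℕ => hcon (n + 1) (by positivity)
  obtain ⟨φ, hφ, hcase⟩ := hN f hf
  obtain ⟨δ, hδ, hδU⟩ := hK.exists_cthickening_subset_open hUo hKU
  have hK' : IsCompact (cthickening δ K) := hK.cthickening
  have hR : 0 < δ / 2 := by linarith
  have hball : ∀ n, closedBall (x n) (2 * (δ / 2)) ⊆ cthickening δ K := fun n => by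
    rw [mul_div_cancel₀ _ two_ne_zero]
    exact closedBall_subset_cthickening (hx n) δ
  have key : ∀ M : ℝ, ¬ ∀ᶠ n in atTop, tilde (f (φ n)) (x (φ n)) ≤ M := by
    intro M h
    obtain ⟨N, hN⟩ := exists_nat_gt M
    obtain ⟨n, h1, h2⟩ := (h.and (eventually_ge_atTop N)).exists
    have h3 := hbig (φ n)
    have h4 : (N : ℝ) ≤ φ n := by exact_mod_cast h2.trans (hφ.id_le n)
    linarith
  have hh : ∀ n, HarmOn U (f (φ n)) := fun n => hFam _ (hf _)
  obtain ⟨C, hC, H⟩ := grad_est m hR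
  obtain ⟨C', hC', H'⟩ := tilde_pos_case m hR
  rcases hcase with ⟨g, hg, hlim⟩ | hlim | hlim
  · have hTC : TC U (fun n x => sr (f (φ n) x)) (fun x => sr (g x)) := by
      intro K hKU hK ε hε
      obtain ⟨N, hN⟩ := hlim K hKU hK ε hε
      refine ⟨N, fun n hn x hx => ?_⟩
      have := hN n hn x hx
      rwa [SF_coe, SF_coe] at this
    obtain ⟨M, hM⟩ := hTC.bdd hδU hK'
      (sr_continuous.comp_continuousOn (hg.1.continuousOn.mono hδU)) fun x _ => sr_abs_lt _
    apply key (C * (M + M))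
    filter_upwards [hM] with n hn
    have h1 := H U hUo _ ((hh n).add_const M) (x (φ n)) ((hball _).trans hδU) (fun y hy => by
      linarith [(abs_le.1 (hn y (hball _ hy))).1])
    rw [fderiv_add_const] at h1
    have h2 := (abs_le.1 (hn _ (hball (φ n) (mem_closedBall_self (by linarith))))).2
    rw [tilde_eq]
    calc _ ≤ ‖fderiv ℝ (f (φ n)) (x (φ n))‖ := div_le_self (norm_nonneg _) (Real.one_le_cosh _)
      _ ≤ _ := h1
      _ ≤ _ := by gcongr
  · apply key C'
    obtain ⟨N, hN⟩ := hlim _ hδU hK' (Real.pi / 2) (by linarith [Real.pi_pos])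
    filter_upwards [eventually_ge_atTop N] with n hn
    refine H' U hUo _ (hh n) _ ((hball _).trans hδU) fun y hy => ?_
    have := hN n hn y (hball _ hy)
    rw [SF_coe, SF_top, abs_lt] at this
    have : sr 0 < sr (f (φ n) y) := by rw [sr_zero]; linarith
    exact (sr_strictMono.lt_iff_lt.1 this).le
  · apply key C'
    obtain ⟨N, hN⟩ := hlim _ hδU hK' (Real.pi / 2) (by linarith [Real.pi_pos])
    filter_upwards [eventually_ge_atTop N] with n hn
    rw [← tilde_neg]
    refine H' U hUo _ (hh n).neg _ ((hball _).trans hδU) fun y hy => ?_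
    have := hN n hn y (hball _ hy)
    rw [SF_coe, SF_bot, abs_lt] at this
    have : sr (f (φ n) y) < sr 0 := by rw [sr_zero]; linarith
    linarith [sr_strictMono.lt_iff_lt.1 this]

/-- **Marty-type normality criterion.** A family of harmonic functions on a domain `U` is
normal iff `f̃` is locally uniformly bounded on `U`, uniformly in the family. -/
theorem stmt7 {m : ℕ} (U : Set (E m)) (hUo : IsOpen U) (hUc : IsConnected U)
    (Fam : Set (E m → ℝ)) (hFam : ∀ f ∈ Fam, HarmOn U f) :
    NormalFam U Fam ↔
      ∀ K ⊆ U, IsCompact K → ∃ M : ℝ, 0 < M ∧ ∀ f ∈ Fam, ∀ x ∈ K, tilde f x ≤ M := by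
  exact ⟨forward hUo hFam, backward hUo hUc hFam⟩
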